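/- arXiv:2307.00246 — 4 statements merged into one kernel-verified Lean document; each statement's English description precedes it below -/
import Mathlib

section
/- Let X and Y be nonempty finite types, P a pmf on X, d : X × Y → ℝ≥0 a distortion function, and D ≥ 0. Define the rate-distortion function R(D) as the infimum, over all stochastic kernels k from X to Y satisfying Σ_{x,y} P(x) k(x)(y) d(x,y) ≤ D, of the mutual information I(P⋉k) = KL(P⋉k ‖ P ⊗ (P⋉k)_Y); and define the Sinkhorn-distortion function S(D) as the infimum, over all pmfs Q on Y and all couplings π ∈ Π(P,Q) satisfying E_π[d] ≤ D, of KL(π ‖ P ⊗ Q). Then R(D) = S(D). -/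
open scoped BigOperators NNReal

/-- A pmf on a finite type: nonnegative real-valued function summing to 1. -/
def IsPMF {α : Type*} [Fintype α] (p : α → ℝ) : Prop :=
  (∀ a, 0 ≤ p a) ∧ ∑ a, p a = 1

/-- KL divergence between pmfs on a finite type, valued in `EReal`:
`+∞` if absolute continuity fails, else `∑ p z * log (p z / q z)`
(with the convention `0 * log (0 / q z) = 0`). -/
noncomputable def KL {α : Type*} [Fintype α] (p q : α → ℝ) : EReal :=
  if ∃ a, 0 < p a ∧ q a = 0 then (⊤ : EReal)
  else ((∑ a, p a * Real.log (p a / q a) : ℝ) : EReal)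

/-- Sinkhorn-rate-distortion equivalence: `R(D) = S(D)`, where `R(D)` is the
infimum over distortion-`D` kernels of the mutual information
`KL(P⋉k ‖ P ⊗ (P⋉k)_Y)`, and `S(D)` is the infimum over output pmfs `Q` and
distortion-`D` couplings `π ∈ Π(P,Q)` of `KL(π ‖ P ⊗ Q)`. -/
theorem rate_distortion_eq_sinkhorn_distortion
    {X Y : Type*} [Fintype X] [Fintype Y] [Nonempty X] [Nonempty Y]
    (P : X → ℝ) (hP : IsPMF P) (d : X × Y → ℝ≥0) (D : ℝ) (hD : 0 ≤ D) :
    sInf {v : EReal | ∃ k : X → Y → ℝ, (∀ x, IsPMF (k x)) ∧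
        (∑ x, ∑ y, P x * k x y * (d (x, y) : ℝ)) ≤ D ∧
        v = KL (fun z : X × Y => P z.1 * k z.1 z.2)
               (fun z : X × Y => P z.1 * ∑ x, P x * k x z.2)} =
    sInf {v : EReal | ∃ Q : Y → ℝ, IsPMF Q ∧
        ∃ π : X × Y → ℝ, IsPMF π ∧
          (∀ x, ∑ y, π (x, y) = P x) ∧ (∀ y, ∑ x, π (x, y) = Q y) ∧
          (∑ z : X × Y, π z * (d z : ℝ)) ≤ D ∧
          v = KL π (fun z : X × Y => P z.1 * Q z.2)} := by
  classical
  congr 1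
  ext v
  constructor
  · rintro ⟨k, hk, hd, rfl⟩
    have hsum : ∑ y, ∑ x, P x * k x y = 1 := by
      rw [Finset.sum_comm]
      simp_rw [← Finset.mul_sum, (hk _).2, mul_one]
      exact hP.2
    refine ⟨fun y => ∑ x, P x * k x y,
      ⟨fun y => Finset.sum_nonneg fun x _ => mul_nonneg (hP.1 x) ((hk x).1 y), hsum⟩,
      fun z => P z.1 * k z.1 z.2,
      ⟨fun z => mul_nonneg (hP.1 _) ((hk _).1 _), ?_⟩, ?_, fun y => rfl, ?_, rfl⟩
    · rw [Fintype.sum_prod_type_right]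
      exact hsum
    · intro x
      simp only
      rw [← Finset.mul_sum, (hk x).2, mul_one]
    · rw [Fintype.sum_prod_type]
      exact hd
  · rintro ⟨Q, hQ, π, hπ, h1, h2, hd, rfl⟩
    obtain ⟨y0⟩ := ‹Nonempty Y›
    let k : X → Y → ℝ := fun x y => if P x = 0 then (if y = y0 then 1 else 0) else π (x, y) / P x
    have hmul : ∀ x y, P x * k x y = π (x, y) := by
      intro x y
      by_cases h : P x = 0
      · have h3 := h1 x
        rw [h, Finset.sum_eq_zero_iff_of_nonneg (fun y _ => hπ.1 (x, y))] at h3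
        rw [h, h3 y (Finset.mem_univ y), zero_mul]
      · simp only [k, if_neg h]
        field_simp
    refine ⟨k, ?_, ?_, ?_⟩
    · intro x
      by_cases h : P x = 0
      · refine ⟨fun y => ?_, ?_⟩
        · simp only [k, if_pos h]
          split_ifs <;> norm_num
        · simp [k, h]
      · refine ⟨fun y => ?_, ?_⟩
        · simp only [k, if_neg h]
          exact div_nonneg (hπ.1 _) (hP.1 _)
        · simp only [k, if_neg h]
          rw [← Finset.sum_div, h1, div_self h]
    · simp_rw [hmul]
      rw [Fintype.sum_prod_type] at hd
      exact hd
    · simp_rw [hmul, h2]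
end

section
/- Let X and Y be nonempty finite types, P a pmf on X, d : X × Y → ℝ≥0 a distortion function, and λ > 0. Then the infimum over all pmfs Q on Y and all couplings π ∈ Π(P,Q) of [KL(π ‖ P ⊗ Q) + λ·E_π[d]] equals the infimum over all stochastic kernels k from X to Y of [KL(P⋉k ‖ P ⊗ (P⋉k)_Y) + λ·Σ_{x,y} P(x) k(x)(y) d(x,y)]. That is, the Lagrangian-regularized extremal entropic optimal transport problem and the Lagrangian-regularized rate-distortion problem have the same optimal value. -/
open scoped BigOperators NNReal

/-- The Lagrangian-regularized extremal entropic optimal transport problem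
(infimum over output pmfs `Q` and couplings `π ∈ Π(P,Q)` of
`KL(π ‖ P ⊗ Q) + λ E_π[d]`) has the same optimal value as the
Lagrangian-regularized rate-distortion problem (infimum over kernels `k` of
`KL(P⋉k ‖ P ⊗ (P⋉k)_Y) + λ Σ_{x,y} P x · k x y · d(x,y)`). -/
theorem lagrangian_sinkhorn_eq_lagrangian_rate_distortion
    {X Y : Type*} [Fintype X] [Fintype Y] [Nonempty X] [Nonempty Y]
    (P : X → ℝ) (hP : IsPMF P) (d : X × Y → ℝ≥0) (lam : ℝ) (hlam : 0 < lam) :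
    sInf {v : EReal | ∃ Q : Y → ℝ, IsPMF Q ∧
        ∃ π : X × Y → ℝ, IsPMF π ∧
          (∀ x, ∑ y, π (x, y) = P x) ∧ (∀ y, ∑ x, π (x, y) = Q y) ∧
          v = KL π (fun z : X × Y => P z.1 * Q z.2)
              + ((lam * ∑ z : X × Y, π z * (d z : ℝ) : ℝ) : EReal)} =
    sInf {v : EReal | ∃ k : X → Y → ℝ, (∀ x, IsPMF (k x)) ∧
        v = KL (fun z : X × Y => P z.1 * k z.1 z.2)
               (fun z : X × Y => P z.1 * ∑ x, P x * k x z.2)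
            + ((lam * ∑ x, ∑ y, P x * k x y * (d (x, y) : ℝ) : ℝ) : EReal)} := by
  congr 1
  ext v
  constructor
  · rintro ⟨Q, hQ, π, hπ, h1, h2, rfl⟩
    obtain ⟨y0⟩ := ‹Nonempty Y›
    classical
    have hk : ∀ x y, P x * (if P x = 0 then (if y = y0 then (1:ℝ) else 0) else π (x, y) / P x)
        = π (x, y) := by
      intro x y
      by_cases hx : P x = 0
      · have h := h1 x
        rw [hx, Finset.sum_eq_zero_iff_of_nonneg (fun y _ => hπ.1 _)] at h
        rw [hx, h y (Finset.mem_univ _), zero_mul]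
      · rw [if_neg hx]
        field_simp
    refine ⟨fun x y => if P x = 0 then (if y = y0 then (1:ℝ) else 0) else π (x, y) / P x, ?_, ?_⟩
    · intro x
      by_cases hx : P x = 0
      · refine ⟨fun y => ?_, ?_⟩
        · simp only [hx, if_true]
          split_ifs <;> norm_num
        · simp [hx]
      · refine ⟨fun y => ?_, ?_⟩
        · simp only [hx, if_false]
          exact div_nonneg (hπ.1 _) (hP.1 _)
        · simp only [hx, if_false]
          rw [← Finset.sum_div, h1 x, div_self hx]
    · simp only [hk, h2]
      rw [Fintype.sum_prod_type]
  · rintro ⟨k, hk, rfl⟩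
    have hnn : ∀ x y, 0 ≤ P x * k x y := fun x y => mul_nonneg (hP.1 x) ((hk x).1 y)
    have hs : ∀ x, ∑ y, P x * k x y = P x := by
      intro x
      rw [← Finset.mul_sum, (hk x).2, mul_one]
    refine ⟨fun y => ∑ x, P x * k x y, ⟨fun y => Finset.sum_nonneg fun x _ => hnn x y, ?_⟩,
      fun z => P z.1 * k z.1 z.2, ⟨fun z => hnn _ _, ?_⟩, hs, fun y => rfl, ?_⟩
    · rw [Finset.sum_comm]
      simp only [hs, hP.2]
    · rw [Fintype.sum_prod_type]
      simp only [hs, hP.2]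
    · rw [Fintype.sum_prod_type]
end

section
/- Let X and Y be nonempty finite types, P a pmf on X, d : X × Y → ℝ≥0, λ > 0, and Q a pmf on Y with Q(y) > 0 for all y. Let Z(x) = Σ_{y'} Q(y')·exp(−λ·d(x,y')). Suppose the normalization condition Σ_x P(x)·exp(−λ·d(x,y)) / Z(x) = 1 holds for every y ∈ Y. Then the infimum over all stochastic kernels k from X to Y of [KL(P⋉k ‖ P ⊗ Q) + λ·Σ_{x,y} P(x) k(x)(y) d(x,y)] equals the infimum over all couplings π ∈ Π(P,Q) of [KL(π ‖ P ⊗ Q) + λ·E_π[d]]; i.e., for this fixed Q the Lagrangian rate problem and the entropic optimal transport problem S_{1/λ}(P,Q) have the same optimal value. -/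
open scoped BigOperators NNReal

lemma aux_pt {p z e q m : ℝ} (hp : 0 ≤ p) (hz : 0 < z) (hq : 0 < q) (hm : 0 ≤ m)
    (h0 : p = 0 → m = 0) :
    m - p * (q * Real.exp (-e) / z) ≤
      m * Real.log (m / (p * q)) + m * e + m * Real.log z := by
  rcases hm.eq_or_lt with h | h
  · subst h
    have : 0 ≤ p * (q * Real.exp (-e) / z) := by positivity
    simp; linarith
  · have hp' : 0 < p := lt_of_le_of_ne hp (fun hh => by
      have := h0 hh.symm
      linarith)
    set s := p * (q * Real.exp (-e) / z) with hs
    have hspos : 0 < s := by positivity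
    have hl : Real.log (s / m) = -(Real.log (m / (p * q)) + e + Real.log z) := by
      rw [Real.log_div hspos.ne' h.ne', hs, Real.log_mul hp'.ne' (by positivity),
        Real.log_div (by positivity) hz.ne', Real.log_mul hq.ne' (by positivity),
        Real.log_exp, Real.log_div h.ne' (by positivity), Real.log_mul hp'.ne' hq.ne']
      ring
    have h1 := Real.log_le_sub_one_of_pos (show 0 < s / m by positivity)
    have h2 := mul_le_mul_of_nonneg_left h1 h.le
    rw [hl] at h2
    have h3 : m * (s / m - 1) = s - m := by field_simp
    rw [h3] at h2
    linarith

lemma aux_eq {p z e q : ℝ} (hp : 0 ≤ p) (hz : 0 < z) (hq : 0 < q) :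
    p * (q * Real.exp (-e) / z) * Real.log (p * (q * Real.exp (-e) / z) / (p * q))
      + p * (q * Real.exp (-e) / z) * e + p * (q * Real.exp (-e) / z) * Real.log z = 0 := by
  rcases hp.eq_or_lt with h | h
  · subst h; simp
  · have : p * (q * Real.exp (-e) / z) / (p * q) = Real.exp (-e) / z := by field_simp
    rw [this, Real.log_div (by positivity) hz.ne', Real.log_exp]
    ring

lemma aux_KL {X Y : Type*} [Fintype X] [Fintype Y] (P : X → ℝ) (Q : Y → ℝ)
    (hQpos : ∀ y, 0 < Q y) (m : X × Y → ℝ) (h0 : ∀ x y, P x = 0 → m (x, y) = 0) :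
    KL m (fun z : X × Y => P z.1 * Q z.2) =
      ((∑ z : X × Y, m z * Real.log (m z / (P z.1 * Q z.2)) : ℝ) : EReal) := by
  unfold KL
  rw [if_neg]
  rintro ⟨⟨x, y⟩, h1, h2⟩
  rcases mul_eq_zero.1 h2 with h | h
  · have := h0 x y h
    linarith
  · exact (hQpos y).ne' h

/-- The common value. -/
lemma aux_marg {X Y : Type*} [Fintype X] [Fintype Y] (P Z : X → ℝ) (m : X × Y → ℝ)
    (hm : ∀ x, ∑ y, m (x, y) = P x) :
    ∑ z : X × Y, m z * Real.log (Z z.1) = ∑ x, P x * Real.log (Z x) := by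
  rw [Fintype.sum_prod_type]
  refine Finset.sum_congr rfl fun x _ => ?_
  simp only
  rw [← Finset.sum_mul, hm]

lemma aux_le {X Y : Type*} [Fintype X] [Fintype Y] (P : X → ℝ) (hP : IsPMF P)
    (d : X × Y → ℝ≥0) (lam : ℝ) (Q : Y → ℝ) (hQpos : ∀ y, 0 < Q y)
    (Z : X → ℝ) (hZ : ∀ x, Z x = ∑ y', Q y' * Real.exp (-(lam * (d (x, y') : ℝ))))
    (hZpos : ∀ x, 0 < Z x)
    (m : X × Y → ℝ) (hm0 : ∀ z, 0 ≤ m z) (hm : ∀ x, ∑ y, m (x, y) = P x) :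
    ((-∑ x, P x * Real.log (Z x) : ℝ) : EReal) ≤ KL m (fun z : X × Y => P z.1 * Q z.2)
      + ((lam * ∑ z : X × Y, m z * (d z : ℝ) : ℝ) : EReal) := by
  have h0 : ∀ x y, P x = 0 → m (x, y) = 0 := by
    intro x y hx
    have := hm x
    rw [hx, Finset.sum_eq_zero_iff_of_nonneg (fun y _ => hm0 (x, y))] at this
    exact this y (Finset.mem_univ y)
  rw [aux_KL P Q hQpos m h0, ← EReal.coe_add, EReal.coe_le_coe_iff, ← aux_marg P Z m hm]
  have hs := Finset.sum_le_sum (s := (Finset.univ : Finset (X × Y))) fun z _ =>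
    aux_pt (e := lam * d z) (hP.1 z.1) (hZpos z.1) (hQpos z.2) (hm0 z) (h0 z.1 z.2)
  rw [Finset.sum_sub_distrib, Finset.sum_add_distrib, Finset.sum_add_distrib] at hs
  have h1 : ∑ z : X × Y, m z = 1 := by
    rw [Fintype.sum_prod_type, ← hP.2]
    exact Finset.sum_congr rfl fun x _ => hm x
  have h2 : ∑ z : X × Y, P z.1 * (Q z.2 * Real.exp (-(lam * (d z : ℝ))) / Z z.1) = 1 := by
    rw [Fintype.sum_prod_type, ← hP.2]
    refine Finset.sum_congr rfl fun x _ => ?_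
    simp only
    rw [← Finset.mul_sum, ← Finset.sum_div, ← hZ, div_self (hZpos x).ne', mul_one]
  have h3 : ∑ z : X × Y, m z * (lam * (d z : ℝ)) = lam * ∑ z : X × Y, m z * (d z : ℝ) := by
    rw [Finset.mul_sum]
    exact Finset.sum_congr rfl fun x _ => by ring
  rw [h1, h2, h3] at hs
  linarith

/-- If `Q` has full support and the Gibbs normalization condition
`Σ_x P x * exp(-λ d(x,y)) / Z x = 1` holds for every `y`, then for this fixed
`Q` the Lagrangian rate problem (infimum over kernels) and the entropic optimal
transport problem `S_{1/λ}(P,Q)` (infimum over couplings `π ∈ Π(P,Q)`) have the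
same optimal value. -/
theorem lagrangian_rate_eq_entropic_ot_of_normalization
    {X Y : Type*} [Fintype X] [Fintype Y] [Nonempty X] [Nonempty Y]
    (P : X → ℝ) (hP : IsPMF P) (d : X × Y → ℝ≥0) (lam : ℝ) (hlam : 0 < lam)
    (Q : Y → ℝ) (hQ : IsPMF Q) (hQpos : ∀ y, 0 < Q y)
    (Z : X → ℝ) (hZ : ∀ x, Z x = ∑ y', Q y' * Real.exp (-(lam * (d (x, y') : ℝ))))
    (hnorm : ∀ y, ∑ x, P x * Real.exp (-(lam * (d (x, y) : ℝ))) / Z x = 1) :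
    sInf {v : EReal | ∃ k : X → Y → ℝ, (∀ x, IsPMF (k x)) ∧
        v = KL (fun z : X × Y => P z.1 * k z.1 z.2)
               (fun z : X × Y => P z.1 * Q z.2)
            + ((lam * ∑ x, ∑ y, P x * k x y * (d (x, y) : ℝ) : ℝ) : EReal)} =
    sInf {v : EReal | ∃ π : X × Y → ℝ, IsPMF π ∧
        (∀ x, ∑ y, π (x, y) = P x) ∧ (∀ y, ∑ x, π (x, y) = Q y) ∧
        v = KL π (fun z : X × Y => P z.1 * Q z.2)
            + ((lam * ∑ z : X × Y, π z * (d z : ℝ) : ℝ) : EReal)} := by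
  have hZpos : ∀ x, 0 < Z x := by
    intro x
    rw [hZ]
    exact Finset.sum_pos (fun y _ => mul_pos (hQpos y) (Real.exp_pos _)) Finset.univ_nonempty
  let k : X → Y → ℝ := fun x y => Q y * Real.exp (-(lam * (d (x, y) : ℝ))) / Z x
  have hk0 : ∀ x y, 0 ≤ k x y := fun x y =>
    div_nonneg (mul_nonneg (hQpos y).le (Real.exp_pos _).le) (hZpos x).le
  have hk1 : ∀ x, ∑ y, k x y = 1 := by
    intro x
    simp only [k]
    rw [← Finset.sum_div, ← hZ, div_self (hZpos x).ne']
  let m : X × Y → ℝ := fun z => P z.1 * k z.1 z.2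
  have hm0 : ∀ z, 0 ≤ m z := fun z => mul_nonneg (hP.1 _) (hk0 _ _)
  have hmP : ∀ x, ∑ y, m (x, y) = P x := by
    intro x
    simp only [m]
    rw [← Finset.mul_sum, hk1, mul_one]
  have hmQ : ∀ y, ∑ x, m (x, y) = Q y := by
    intro y
    have : ∑ x, m (x, y) = Q y * ∑ x, P x * Real.exp (-(lam * (d (x, y) : ℝ))) / Z x := by
      rw [Finset.mul_sum]
      exact Finset.sum_congr rfl fun x _ => by simp only [m, k]; ring
    rw [this, hnorm, mul_one]
  have hm1 : ∑ z, m z = 1 := by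
    rw [Fintype.sum_prod_type, ← hP.2]
    exact Finset.sum_congr rfl fun x _ => hmP x
  have hval : ((-∑ x, P x * Real.log (Z x) : ℝ) : EReal) = KL m (fun z : X × Y => P z.1 * Q z.2)
      + ((lam * ∑ z : X × Y, m z * (d z : ℝ) : ℝ) : EReal) := by
    rw [aux_KL P Q hQpos m (fun x y h => by simp [m, h]), ← EReal.coe_add, EReal.coe_eq_coe_iff,
      ← aux_marg P Z m hmP]
    have hs : ∑ z : X × Y, (m z * Real.log (m z / (P z.1 * Q z.2)) + m z * (lam * (d z : ℝ))
        + m z * Real.log (Z z.1)) = 0 :=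
      Finset.sum_eq_zero fun z _ =>
        aux_eq (e := lam * d z) (hP.1 z.1) (hZpos z.1) (hQpos z.2)
    rw [Finset.sum_add_distrib, Finset.sum_add_distrib] at hs
    have h3 : ∑ z : X × Y, m z * (lam * (d z : ℝ)) = lam * ∑ z : X × Y, m z * (d z : ℝ) := by
      rw [Finset.mul_sum]
      exact Finset.sum_congr rfl fun x _ => by ring
    rw [h3] at hs
    linarith
  have hprod : ∀ k' : X → Y → ℝ, ∑ x, ∑ y, P x * k' x y * (d (x, y) : ℝ)
      = ∑ z : X × Y, (fun z : X × Y => P z.1 * k' z.1 z.2) z * (d z : ℝ) := by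
    intro k'
    rw [Fintype.sum_prod_type]
  trans ((-∑ x, P x * Real.log (Z x) : ℝ) : EReal)
  · apply le_antisymm
    · refine sInf_le ⟨k, fun x => ⟨hk0 x, hk1 x⟩, ?_⟩
      rw [hprod]
      exact hval
    · refine le_sInf ?_
      rintro v ⟨k', hk', rfl⟩
      rw [hprod]
      refine aux_le P hP d lam Q hQpos Z hZ hZpos _
        (fun z => mul_nonneg (hP.1 _) ((hk' _).1 _)) (fun x => ?_)
      simp only
      rw [← Finset.mul_sum, (hk' x).2, mul_one]
  · apply le_antisymm
    · refine le_sInf ?_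
      rintro v ⟨π, hπ, hπP, -, rfl⟩
      exact aux_le P hP d lam Q hQpos Z hZ hZpos π hπ.1 hπP
    · exact sInf_le ⟨m, ⟨hm0, hm1⟩, hmP, hmQ, hval⟩
end

section
/- Let X and Y be nonempty finite types, P a pmf on X, d : X × Y → ℝ≥0, λ > 0, and Q a pmf on Y with Q(y) > 0 for all y. Then the minimum over all stochastic kernels k from X to Y of [KL(P⋉k ‖ P ⊗ Q) + λ·Σ_{x,y} P(x) k(x)(y) d(x,y)] equals −Σ_x P(x)·log Z(x), where Z(x) = Σ_{y'} Q(y')·exp(−λ·d(x,y')), and this minimum is attained by the Gibbs kernel k*(x)(y) = Q(y)·exp(−λ·d(x,y))/Z(x). -/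
open scoped BigOperators NNReal

theorem gibbs_pt (k q t z : ℝ) (hk : 0 ≤ k) (hq : 0 < q) (hz : 0 < z) :
    k - q * Real.exp (-t) / z - k * Real.log z ≤ k * Real.log (k / q) + k * t := by
  rcases hk.eq_or_lt with rfl | hk
  · have : 0 < q * Real.exp (-t) / z := by positivity
    simp only [zero_mul, zero_sub, sub_zero, add_zero]
    linarith
  · have hpos : 0 < q * Real.exp (-t) / z / k := by positivity
    have h := Real.log_le_sub_one_of_pos hpos
    rw [Real.log_div (by positivity) hk.ne', Real.log_div (by positivity) hz.ne',
      Real.log_mul hq.ne' (by positivity), Real.log_exp] at h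
    rw [Real.log_div hk.ne' hq.ne']
    have h2 := mul_le_mul_of_nonneg_left h hk.le
    have h3 : k * (q * Real.exp (-t) / z / k - 1) = q * Real.exp (-t) / z - k := by
      field_simp
    rw [h3] at h2
    linarith

theorem gibbs_obj {X Y : Type*} [Fintype X] [Fintype Y]
    (P : X → ℝ) (d : X × Y → ℝ≥0) (lam : ℝ)
    (Q : Y → ℝ) (hQpos : ∀ y, 0 < Q y) (k : X → Y → ℝ) :
    KL (fun z : X × Y => P z.1 * k z.1 z.2)
               (fun z : X × Y => P z.1 * Q z.2)
            + ((lam * ∑ x, ∑ y, P x * k x y * (d (x, y) : ℝ) : ℝ) : EReal) =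
    ((∑ x, P x * ∑ y, (k x y * Real.log (k x y / Q y) + k x y * (lam * (d (x, y) : ℝ))) : ℝ) :
      EReal) := by
  have hn : ¬ ∃ a : X × Y, 0 < P a.1 * k a.1 a.2 ∧ P a.1 * Q a.2 = 0 := by
    rintro ⟨a, h1, h2⟩
    rcases mul_eq_zero.1 h2 with h | h
    · simp [h] at h1
    · exact (hQpos _).ne' h
  unfold KL
  rw [if_neg hn, ← EReal.coe_add]
  congr 1
  rw [Fintype.sum_prod_type, Finset.mul_sum, ← Finset.sum_add_distrib]
  refine Finset.sum_congr rfl fun x _ => ?_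
  rw [Finset.mul_sum, Finset.mul_sum, ← Finset.sum_add_distrib]
  refine Finset.sum_congr rfl fun y _ => ?_
  by_cases h : P x = 0
  · simp [h]
  · simp only [mul_div_mul_left _ _ h]
    ring

/-- For a fixed full-support output pmf `Q`, the minimum over stochastic
kernels `k` of `KL(P⋉k ‖ P ⊗ Q) + λ Σ_{x,y} P x k x y d(x,y)` equals
`-Σ_x P x log Z x`, where `Z x = Σ_{y'} Q y' exp(-λ d(x,y'))`, and this
minimum is attained by the Gibbs kernel `k*(x)(y) = Q y exp(-λ d(x,y))/Z x`. -/
theorem gibbs_kernel_minimizes_lagrangian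
    {X Y : Type*} [Fintype X] [Fintype Y] [Nonempty X] [Nonempty Y]
    (P : X → ℝ) (hP : IsPMF P) (d : X × Y → ℝ≥0) (lam : ℝ) (hlam : 0 < lam)
    (Q : Y → ℝ) (hQ : IsPMF Q) (hQpos : ∀ y, 0 < Q y)
    (Z : X → ℝ) (hZ : ∀ x, Z x = ∑ y', Q y' * Real.exp (-(lam * (d (x, y') : ℝ))))
    (kstar : X → Y → ℝ)
    (hkstar : ∀ x y, kstar x y = Q y * Real.exp (-(lam * (d (x, y) : ℝ))) / Z x) :
    sInf {v : EReal | ∃ k : X → Y → ℝ, (∀ x, IsPMF (k x)) ∧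
        v = KL (fun z : X × Y => P z.1 * k z.1 z.2)
               (fun z : X × Y => P z.1 * Q z.2)
            + ((lam * ∑ x, ∑ y, P x * k x y * (d (x, y) : ℝ) : ℝ) : EReal)} =
      ((-∑ x, P x * Real.log (Z x) : ℝ) : EReal) ∧
    (∀ x, IsPMF (kstar x)) ∧
    KL (fun z : X × Y => P z.1 * kstar z.1 z.2)
       (fun z : X × Y => P z.1 * Q z.2)
      + ((lam * ∑ x, ∑ y, P x * kstar x y * (d (x, y) : ℝ) : ℝ) : EReal) =
      ((-∑ x, P x * Real.log (Z x) : ℝ) : EReal) := by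
  have hZpos : ∀ x, 0 < Z x := fun x => by
    rw [hZ]
    exact Finset.sum_pos (fun y _ => mul_pos (hQpos y) (Real.exp_pos _)) Finset.univ_nonempty
  have hsum : ∀ x, ∑ y, kstar x y = 1 := fun x => by
    simp only [hkstar]
    rw [← Finset.sum_div, ← hZ, div_self (hZpos x).ne']
  have hpos : ∀ x y, 0 < kstar x y := fun x y => by
    rw [hkstar]
    exact div_pos (mul_pos (hQpos y) (Real.exp_pos _)) (hZpos x)
  have hpmf : ∀ x, IsPMF (kstar x) := fun x => ⟨fun y => (hpos x y).le, hsum x⟩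
  have heq : KL (fun z : X × Y => P z.1 * kstar z.1 z.2)
       (fun z : X × Y => P z.1 * Q z.2)
      + ((lam * ∑ x, ∑ y, P x * kstar x y * (d (x, y) : ℝ) : ℝ) : EReal) =
      ((-∑ x, P x * Real.log (Z x) : ℝ) : EReal) := by
    rw [gibbs_obj P d lam Q hQpos kstar]
    congr 1
    rw [← Finset.sum_neg_distrib]
    refine Finset.sum_congr rfl fun x _ => ?_
    have : ∀ y, kstar x y * Real.log (kstar x y / Q y) + kstar x y * (lam * (d (x, y) : ℝ))
        = kstar x y * (-Real.log (Z x)) := fun y => by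
      have h1 : kstar x y / Q y = Real.exp (-(lam * (d (x, y) : ℝ))) / Z x := by
        rw [hkstar]
        have := (hQpos y).ne'
        field_simp
      rw [h1, Real.log_div (Real.exp_pos _).ne' (hZpos x).ne', Real.log_exp]
      ring
    simp only [this]
    rw [← Finset.sum_mul, hsum]
    ring
  refine ⟨le_antisymm (sInf_le ⟨kstar, hpmf, heq.symm⟩) (le_sInf ?_), hpmf, heq⟩
  rintro v ⟨k, hk, rfl⟩
  rw [gibbs_obj P d lam Q hQpos k, EReal.coe_le_coe_iff, ← Finset.sum_neg_distrib]
  refine Finset.sum_le_sum fun x _ => ?_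
  rw [← mul_neg]
  refine mul_le_mul_of_nonneg_left ?_ (hP.1 x)
  have h := Finset.sum_le_sum fun y (_ : y ∈ Finset.univ) =>
    gibbs_pt (k x y) (Q y) (lam * (d (x, y) : ℝ)) (Z x) ((hk x).1 y) (hQpos y) (hZpos x)
  simp only [← hkstar] at h
  rw [Finset.sum_sub_distrib, Finset.sum_sub_distrib, ← Finset.sum_mul, (hk x).2, hsum] at h
  linarith
end
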